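/- Let T > 0, let f, g : [0,T] → ℝ be continuously differentiable, and assume moreover that g is real-analytic on [0,T] (i.e., g extends analytically to a neighborhood of [0,T]). Let V : [0,T] → ℝ be continuous and satisfy the mixed Volterra–Fredholm equation V(t) = ∫_0^t f(t−s) V(s) ds + ∫_t^T g(s−t) V(s) ds for all t ∈ [0,T]. If V vanishes identically on some interval [0,ε] with ε > 0, then V ≡ 0 on [0,T]. -/

import Mathlib

open Set intervalIntegral
open Filter Topology MeasureTheory

/-- A real-analytic germ extends to a complex-analytic germ. -/
lemma mvf_complexify {g : ℝ → ℝ} {x₀ : ℝ} (hg : AnalyticAt ℝ g x₀) :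
    ∃ G : ℂ → ℂ, AnalyticAt ℂ G (x₀ : ℂ) ∧ ∀ᶠ x : ℝ in 𝓝 x₀, G x = (g x : ℂ) := by
  obtain ⟨p, hp⟩ := hg
  set q : FormalMultilinearSeries ℂ ℂ ℂ :=
    FormalMultilinearSeries.ofScalars ℂ (fun n => (p.coeff n : ℂ)) with hq
  have hrad : p.radius ≤ q.radius := by
    apply FormalMultilinearSeries.radius_le_of_le
    intro n
    rw [hq, FormalMultilinearSeries.ofScalars_norm]
    simp
  have hpos : 0 < q.radius := lt_of_lt_of_le hp.radius_pos hrad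
  have hqs := q.hasFPowerSeriesOnBall hpos
  refine ⟨fun z => q.sum (z - x₀), ?_, ?_⟩
  · have h1 : AnalyticAt ℂ q.sum ((x₀ : ℂ) - x₀) := by
      rw [sub_self]; exact hqs.analyticAt
    exact AnalyticAt.comp' (f := fun z : ℂ => z - x₀) h1 (by fun_prop)
  · have h2 := hasFPowerSeriesAt_iff.1 hp
    have h3 : Tendsto (fun x : ℝ => x - x₀) (𝓝 x₀) (𝓝 0) := by
      have : ContinuousAt (fun x : ℝ => x - x₀) x₀ := by fun_prop
      simpa [ContinuousAt] using this
    filter_upwards [h3.eventually h2] with x hx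
    simp only [add_sub_cancel] at hx
    have h4 : HasSum (fun n => (((x - x₀) ^ n • p.coeff n : ℝ) : ℂ)) (g x : ℂ) :=
      Complex.hasSum_ofReal.2 hx
    rw [← h4.tsum_eq, FormalMultilinearSeries.sum]
    congr 1
    ext n
    simp [hq, FormalMultilinearSeries.ofScalars_apply_eq, mul_comm]

/-- Local analyticity of the parametric integral. -/
lemma mvf_local {g V : ℝ → ℝ} {a T s₀ : ℝ} (hg : AnalyticAt ℝ g (s₀ - a))
    (hV : ContinuousOn V (Icc a T)) (hs₀ : s₀ ∈ Icc a T) :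
    ∀ᶠ y in 𝓝[Icc a T] s₀, AnalyticAt ℝ (fun t => ∫ s in s₀..y, g (s - t) * V s) a := by
  obtain ⟨G, hG, hGg⟩ := mvf_complexify hg
  obtain ⟨r₁, hr₁, hG1⟩ := Metric.eventually_nhds_iff_ball.1 hG.eventually_analyticAt
  obtain ⟨r₂, hr₂, hG2⟩ := Metric.eventually_nhds_iff_ball.1 hGg
  obtain ⟨r, hr, hrr₁, hrr₂⟩ : ∃ r > 0, 3 * r ≤ r₁ ∧ 3 * r ≤ r₂ :=
    ⟨min r₁ r₂ / 3, by positivity, by linarith [min_le_left r₁ r₂], by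
      linarith [min_le_right r₁ r₂]⟩
  have hGan : AnalyticOnNhd ℂ G (Metric.closedBall (((s₀ - a : ℝ)) : ℂ) (2 * r)) := fun z hz =>
    hG1 z (by
      rw [Metric.mem_closedBall] at hz
      rw [Metric.mem_ball]; linarith)
  obtain ⟨M, hM⟩ := (isCompact_closedBall (((s₀ - a : ℝ)) : ℂ) (2 * r)).exists_bound_of_continuousOn
    hGan.deriv.continuousOn
  have hball : ∀ᶠ y in 𝓝[Icc a T] s₀, y ∈ Metric.ball s₀ r :=
    mem_nhdsWithin_of_mem_nhds (Metric.ball_mem_nhds _ hr)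
  filter_upwards [hball, self_mem_nhdsWithin] with y hy hyI
  have hsub : uIcc s₀ y ⊆ Icc a T := uIcc_subset_Icc hs₀ hyI
  have hsub2 : ∀ s ∈ uIcc s₀ y, |s - s₀| < r := by
    intro s hs
    have h1 := abs_sub_left_of_mem_uIcc hs
    rw [Metric.mem_ball, Real.dist_eq] at hy
    linarith
  have hmem : ∀ z ∈ Metric.ball (a : ℂ) r, ∀ s ∈ uIcc s₀ y,
      (s : ℂ) - z ∈ Metric.closedBall (((s₀ - a : ℝ)) : ℂ) (2 * r) := by
    intro z hz s hs
    rw [Metric.mem_ball, dist_eq_norm] at hz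
    rw [Metric.mem_closedBall, dist_eq_norm]
    have h1 : (s : ℂ) - z - ((s₀ - a : ℝ) : ℂ) = ((s - s₀ : ℝ) : ℂ) - (z - a) := by
      push_cast; ring
    rw [h1]
    have h2 := norm_sub_le ((s - s₀ : ℝ) : ℂ) (z - a)
    rw [Complex.norm_real, Real.norm_eq_abs] at h2
    linarith [hsub2 s hs]
  have hVc : ContinuousOn (fun s => (V s : ℂ)) (uIcc s₀ y) :=
    Complex.continuous_ofReal.comp_continuousOn (hV.mono hsub)
  have hcont : ∀ z ∈ Metric.ball (a : ℂ) r,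
      ContinuousOn (fun s : ℝ => G ((s : ℂ) - z) * (V s : ℂ)) (uIcc s₀ y) := by
    intro z hz
    refine ContinuousOn.mul ?_ hVc
    exact hGan.continuousOn.comp (f := fun s : ℝ => (s : ℂ) - z) (by fun_prop) (hmem z hz)
  have hcont' : ∀ z ∈ Metric.ball (a : ℂ) r,
      ContinuousOn (fun s : ℝ => -(deriv G ((s : ℂ) - z)) * (V s : ℂ)) (uIcc s₀ y) := by
    intro z hz
    refine ContinuousOn.mul (ContinuousOn.neg ?_) hVc
    exact hGan.deriv.continuousOn.comp (f := fun s : ℝ => (s : ℂ) - z) (by fun_prop) (hmem z hz)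
  have hdiff : DifferentiableOn ℂ (fun z : ℂ => ∫ s in s₀..y, G ((s : ℂ) - z) * (V s : ℂ))
      (Metric.ball (a : ℂ) r) := by
    intro z hz
    have key := intervalIntegral.hasDerivAt_integral_of_dominated_loc_of_deriv_le
      (μ := volume) (a := s₀) (b := y)
      (F := fun (z : ℂ) (s : ℝ) => G ((s : ℂ) - z) * (V s : ℂ))
      (F' := fun (z : ℂ) (s : ℝ) => -(deriv G ((s : ℂ) - z)) * (V s : ℂ))
      (x₀ := z) (s := Metric.ball (a : ℂ) r) (bound := fun s => M * ‖(V s : ℂ)‖)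
      (Metric.isOpen_ball.mem_nhds hz)
      (by
        filter_upwards [Metric.isOpen_ball.mem_nhds hz] with w hw
        exact ((hcont w hw).mono uIoc_subset_uIcc).aestronglyMeasurable measurableSet_uIoc)
      (hcont z hz).intervalIntegrable
      (((hcont' z hz).mono uIoc_subset_uIcc).aestronglyMeasurable measurableSet_uIoc)
      (by
        refine ae_of_all _ fun s hs w hw => ?_
        rw [norm_mul, norm_neg]
        exact mul_le_mul_of_nonneg_right (hM _ (hmem w hw s (uIoc_subset_uIcc hs))) (norm_nonneg _))
      (ContinuousOn.intervalIntegrable (continuousOn_const.mul hVc.norm))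
      (by
        refine ae_of_all _ fun s hs w hw => ?_
        have h1 := (hGan _ (hmem w hw s (uIoc_subset_uIcc hs))).differentiableAt.hasDerivAt
        have h2 : HasDerivAt (fun w : ℂ => (s : ℂ) - w) (-1) w := by
          simpa using (hasDerivAt_id w).const_sub (s : ℂ)
        have h3 := (HasDerivAt.comp w h1 h2).mul_const (V s : ℂ)
        simpa using h3)
    exact key.2.differentiableAt.differentiableWithinAt
  have han := hdiff.analyticAt (Metric.ball_mem_nhds (a : ℂ) hr)
  refine han.re_ofReal.congr ?_
  filter_upwards [Metric.ball_mem_nhds a hr] with t ht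
  have h1 : ∫ s in s₀..y, G ((s : ℂ) - (t : ℂ)) * (V s : ℂ)
      = ∫ s in s₀..y, ((g (s - t) * V s : ℝ) : ℂ) := by
    apply intervalIntegral.integral_congr
    intro s hs
    have h2 : G ((s - t : ℝ) : ℂ) = (g (s - t) : ℂ) := by
      apply hG2
      rw [Metric.mem_ball, Real.dist_eq] at ht ⊢
      have h3 := hsub2 s hs
      have h4 := abs_sub (s - s₀) (t - a)
      have h5 : s - t - (s₀ - a) = (s - s₀) - (t - a) := by ring
      rw [h5]; linarith
    push_cast at h2 ⊢
    simp only [h2]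
  simp only [h1, intervalIntegral.integral_ofReal, Complex.ofReal_re]

/-- Joint continuity data near `a`. -/
lemma mvf_cont {g V : ℝ → ℝ} {a T : ℝ} (hg : ∀ s ∈ Icc a T, AnalyticAt ℝ g (s - a))
    (hV : ContinuousOn V (Icc a T)) :
    ∀ᶠ t in 𝓝 a, ContinuousOn (fun s => g (s - t) * V s) (Icc a T) := by
  have h : ∀ᶠ t in 𝓝 a, ∀ s ∈ Icc a T, AnalyticAt ℝ g (s - t) := by
    apply isCompact_Icc.eventually_forall_of_forall_eventually
    intro s hs
    have h1 : ContinuousAt (fun z : ℝ × ℝ => z.2 - z.1) (a, s) := by fun_prop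
    exact h1.eventually (hg s hs).eventually_analyticAt
  filter_upwards [h] with t ht
  refine ContinuousOn.mul (fun s hs => ?_) hV
  exact (ContinuousAt.comp' (f := fun s : ℝ => s - t) (ht s hs).continuousAt
    (by fun_prop)).continuousWithinAt

lemma mvf_analytic {g V : ℝ → ℝ} {a T : ℝ} (haT : a ≤ T)
    (hg : ∀ s ∈ Icc a T, AnalyticAt ℝ g (s - a))
    (hV : ContinuousOn V (Icc a T)) :
    AnalyticAt ℝ (fun t => ∫ s in a..T, g (s - t) * V s) a := by
  refine (isPreconnected_Icc (a := a) (b := T)).induction₂'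
    (fun c d => AnalyticAt ℝ (fun t => ∫ s in c..d, g (s - t) * V s) a) ?_ ?_
    (left_mem_Icc.2 haT) (right_mem_Icc.2 haT)
  · intro x hx
    filter_upwards [mvf_local (hg x hx) hV hx] with y hy
    refine ⟨hy, ?_⟩
    refine hy.neg.congr (Eventually.of_forall fun t => ?_)
    simp only [Pi.neg_apply]
    rw [intervalIntegral.integral_symm y x]
    simp
  · intro x y z hx hy hz hxy hyz
    refine (hxy.add hyz).congr ?_
    filter_upwards [mvf_cont hg hV] with t ht
    exact intervalIntegral.integral_add_adjacent_intervals
      (ht.mono (uIcc_subset_Icc hx hy)).intervalIntegrable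
      (ht.mono (uIcc_subset_Icc hy hz)).intervalIntegrable

/-- One step of propagation. -/
lemma mvf_step {f g V : ℝ → ℝ} {a T : ℝ} (ha : 0 < a) (haT : a < T)
    (hf : ContinuousOn f (Icc 0 T))
    (hganal : AnalyticOnNhd ℝ g (Icc 0 T))
    (hV : ContinuousOn V (Icc 0 T))
    (heq : ∀ t ∈ Icc 0 T,
      V t = (∫ s in (0:ℝ)..t, f (t - s) * V s) + ∫ s in t..T, g (s - t) * V s)
    (h0 : ∀ t ∈ Icc 0 a, V t = 0) :
    ∃ b > a, ∀ t ∈ Icc a b, V t = 0 := by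
  have hV' : ContinuousOn V (Icc a T) := hV.mono (Icc_subset_Icc_left ha.le)
  have hg : ∀ s ∈ Icc a T, AnalyticAt ℝ g (s - a) := fun s hs =>
    hganal _ ⟨by linarith [hs.1], by linarith [hs.2]⟩
  have han := mvf_analytic haT.le hg hV'
  have hzero : ∀ t ∈ Icc 0 a, ∫ s in a..T, g (s - t) * V s = 0 := by
    intro t ht
    have h1 := heq t ⟨ht.1, ht.2.trans haT.le⟩
    have h2 : ∫ s in (0:ℝ)..t, f (t - s) * V s = 0 := by
      rw [intervalIntegral.integral_congr (g := fun _ => 0)]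
      · simp
      · intro s hs
        rw [uIcc_of_le ht.1] at hs
        simp [h0 s ⟨hs.1, hs.2.trans ht.2⟩]
    have h3 : ∫ s in t..a, g (s - t) * V s = 0 := by
      rw [intervalIntegral.integral_congr (g := fun _ => 0)]
      · simp
      · intro s hs
        rw [uIcc_of_le ht.2] at hs
        simp [h0 s ⟨ht.1.trans hs.1, hs.2⟩]
    have hc : ContinuousOn (fun s => g (s - t) * V s) (Icc t T) := by
      refine ContinuousOn.mul ?_ (hV.mono (Icc_subset_Icc_left ht.1))
      refine hganal.continuousOn.comp (f := fun s : ℝ => s - t) (by fun_prop) ?_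
      intro s hs
      exact ⟨by linarith [hs.1], by linarith [hs.2, ht.1]⟩
    have htT : t ≤ T := ht.2.trans haT.le
    have h4 := intervalIntegral.integral_add_adjacent_intervals
      (hc.mono (uIcc_subset_Icc ⟨le_rfl, htT⟩ ⟨ht.2, haT.le⟩)).intervalIntegrable
      (hc.mono (uIcc_subset_Icc ⟨ht.2, haT.le⟩ ⟨htT, le_rfl⟩)).intervalIntegrable
      (μ := volume)
    rw [h0 t ht] at h1
    linarith
  have hev : ∀ᶠ t in 𝓝 a, ∫ s in a..T, g (s - t) * V s = 0 := by
    rcases han.eventually_eq_zero_or_eventually_ne_zero with h | h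
    · exact h
    · exfalso
      have h1 : ∀ᶠ t in 𝓝[<] a, ∫ s in a..T, g (s - t) * V s ≠ 0 :=
        h.filter_mono (nhdsWithin_mono _ fun x hx => ne_of_lt hx)
      have h2 : ∀ᶠ t in 𝓝[<] a, t ∈ Ioo 0 a := Ioo_mem_nhdsLT ha
      obtain ⟨t, ht1, ht2⟩ := (h1.and h2).exists
      exact ht1 (hzero t ⟨ht2.1.le, ht2.2.le⟩)
  obtain ⟨Mf, hMf⟩ := isCompact_Icc.exists_bound_of_continuousOn hf
  have hg0 : ContinuousAt g 0 := (hganal 0 ⟨le_rfl, (ha.trans haT).le⟩).continuousAt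
  have hgb : ∀ᶠ x in 𝓝 (0:ℝ), ‖g x‖ < ‖g 0‖ + 1 :=
    hg0.norm.eventually (gt_mem_nhds (by linarith))
  obtain ⟨r₁, hr₁, hr₁'⟩ := Metric.eventually_nhds_iff_ball.1 (hev.and (mvf_cont hg hV'))
  obtain ⟨r₂, hr₂, hr₂'⟩ := Metric.eventually_nhds_iff_ball.1 hgb
  set M : ℝ := |Mf| + (‖g 0‖ + 1) with hMdef
  have hMpos : 0 < M := by positivity
  obtain ⟨η, hη, hη1, hη2, hηT, hηM⟩ : ∃ η > 0, η < r₁ ∧ η < r₂ ∧ a + η ≤ T ∧ M * η < 1 := by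
    have h1 : ∀ᶠ η in 𝓝[>] (0:ℝ), η ∈ Ioo 0 (min (min r₁ r₂) (min (T - a) (1 / M))) :=
      Ioo_mem_nhdsGT (by
        have : 0 < T - a := by linarith
        positivity)
    obtain ⟨η, hη⟩ := h1.exists
    simp only [mem_Ioo, lt_min_iff] at hη
    obtain ⟨hp, ⟨ha1, ha2⟩, ha3, ha4⟩ := hη
    refine ⟨η, hp, ha1, ha2, by linarith, ?_⟩
    rw [lt_div_iff₀ hMpos] at ha4
    linarith
  refine ⟨a + η, by linarith, ?_⟩
  have hVη : ContinuousOn V (Icc a (a + η)) := hV'.mono (Icc_subset_Icc_right hηT)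
  obtain ⟨m, hm, hmax⟩ := isCompact_Icc.exists_isMaxOn
    (nonempty_Icc.2 (by linarith : a ≤ a + η)) hVη.norm
  have hmax' : ∀ t ∈ Icc a (a + η), ‖V t‖ ≤ ‖V m‖ := fun t ht => hmax ht
  suffices hVm : ‖V m‖ = 0 by
    intro t ht
    have := hmax' t ht
    rw [hVm] at this
    exact norm_le_zero_iff.1 this
  have hm0T : m ∈ Icc 0 T := ⟨by linarith [hm.1], by linarith [hm.2]⟩
  have hmaT : m ∈ Icc a T := ⟨hm.1, hm0T.2⟩
  have hmr := hr₁' m (by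
    rw [Metric.mem_ball, Real.dist_eq, abs_of_nonneg (by linarith [hm.1])]; linarith [hm.2])
  have hcf : ContinuousOn (fun s => f (m - s) * V s) (Icc 0 m) := by
    refine ContinuousOn.mul ?_ (hV.mono (Icc_subset_Icc_right hm0T.2))
    refine hf.comp (f := fun s : ℝ => m - s) (by fun_prop) ?_
    intro s hs
    exact ⟨by linarith [hs.2], by linarith [hs.1, hm0T.2]⟩
  have e1 : ∫ s in (0:ℝ)..a, f (m - s) * V s = 0 := by
    rw [intervalIntegral.integral_congr (g := fun _ => 0)]
    · simp
    · intro s hs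
      rw [uIcc_of_le ha.le] at hs
      simp [h0 s hs]
  have e2 := intervalIntegral.integral_add_adjacent_intervals
      (hcf.mono (uIcc_subset_Icc ⟨le_rfl, hm0T.1⟩ ⟨ha.le, hm.1⟩)).intervalIntegrable
      (hcf.mono (uIcc_subset_Icc ⟨ha.le, hm.1⟩ ⟨hm0T.1, le_rfl⟩)).intervalIntegrable
      (μ := volume)
  have e3 := intervalIntegral.integral_add_adjacent_intervals
      (hmr.2.mono (uIcc_subset_Icc ⟨le_rfl, haT.le⟩ hmaT)).intervalIntegrable
      (hmr.2.mono (uIcc_subset_Icc hmaT ⟨haT.le, le_rfl⟩)).intervalIntegrable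
      (μ := volume)
  have b1 : ‖∫ s in a..m, f (m - s) * V s‖ ≤ (|Mf| * ‖V m‖) * |m - a| := by
    apply intervalIntegral.norm_integral_le_of_norm_le_const
    intro s hs
    rw [uIoc_of_le hm.1] at hs
    rw [norm_mul]
    have i1 := hMf (m - s) ⟨by linarith [hs.2], by linarith [hs.1, hm0T.2]⟩
    exact mul_le_mul (i1.trans (le_abs_self _)) (hmax' s ⟨hs.1.le, hs.2.trans hm.2⟩)
      (norm_nonneg _) (abs_nonneg _)
  have b2 : ‖∫ s in a..m, g (s - m) * V s‖ ≤ ((‖g 0‖ + 1) * ‖V m‖) * |m - a| := by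
    apply intervalIntegral.norm_integral_le_of_norm_le_const
    intro s hs
    rw [uIoc_of_le hm.1] at hs
    rw [norm_mul]
    have i1 := hr₂' (s - m) (by
      rw [Metric.mem_ball, Real.dist_eq, sub_zero, abs_of_nonpos (by linarith [hs.2])]
      linarith [hs.1, hm.2])
    exact mul_le_mul i1.le (hmax' s ⟨hs.1.le, hs.2.trans hm.2⟩)
      (norm_nonneg _) (by positivity)
  have e4 : V m = (∫ s in a..m, f (m - s) * V s) - ∫ s in a..m, g (s - m) * V s := by
    have := heq m hm0T
    have := hmr.1
    linarith
  have b3 := norm_sub_le (∫ s in a..m, f (m - s) * V s) (∫ s in a..m, g (s - m) * V s)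
  rw [← e4] at b3
  have hma : |m - a| ≤ η := by
    rw [abs_of_nonneg (by linarith [hm.1])]; linarith [hm.2]
  have b4 : ‖V m‖ ≤ (M * η) * ‖V m‖ := by
    have : M * ‖V m‖ * |m - a| ≤ M * ‖V m‖ * η := by gcongr
    have e5 : M * ‖V m‖ * |m - a| =
      |Mf| * ‖V m‖ * |m - a| + (‖g 0‖ + 1) * ‖V m‖ * |m - a| := by rw [hMdef]; ring
    linarith
  have b5 := norm_nonneg (V m)
  nlinarith

/-- If `V` is continuous on `[0,T]`, satisfies the mixed Volterra–Fredholm equation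
`V(t) = ∫_0^t f(t-s) V(s) ds + ∫_t^T g(s-t) V(s) ds` with `f, g` of class `C¹` and `g`
real-analytic on `[0,T]`, and `V` vanishes on some `[0, ε]` with `ε > 0`, then `V ≡ 0`. -/
theorem mixed_volterra_fredholm_vanishing
    (T : ℝ) (hT : 0 < T) (f g V : ℝ → ℝ)
    (hf : ContDiffOn ℝ 1 f (Set.Icc 0 T))
    (hg : ContDiffOn ℝ 1 g (Set.Icc 0 T))
    (hganal : AnalyticOnNhd ℝ g (Set.Icc 0 T))
    (hV : ContinuousOn V (Set.Icc 0 T))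
    (heq : ∀ t ∈ Set.Icc 0 T,
      V t = (∫ s in (0:ℝ)..t, f (t - s) * V s) + ∫ s in t..T, g (s - t) * V s)
    (ε : ℝ) (hε : 0 < ε)
    (hvanish : ∀ t ∈ Set.Icc 0 ε, V t = 0) :
    ∀ t ∈ Set.Icc 0 T, V t = 0 := by
  by_contra! hcon
  obtain ⟨t₀, ht₀, hVt₀⟩ := hcon
  set S : Set ℝ := {t | t ∈ Icc 0 T ∧ V t ≠ 0} with hS
  have hSne : S.Nonempty := ⟨t₀, ht₀, hVt₀⟩
  have hlow : ∀ t ∈ S, ε ≤ t := by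
    intro t ht
    by_contra! hlt
    exact ht.2 (hvanish t ⟨ht.1.1, hlt.le⟩)
  have hSb : BddBelow S := ⟨ε, hlow⟩
  set a := sInf S with ha_def
  have haε : ε ≤ a := le_csInf hSne hlow
  have ha : 0 < a := hε.trans_le haε
  have hat₀ : a ≤ t₀ := csInf_le hSb ⟨ht₀, hVt₀⟩
  have haT' : a ≤ T := hat₀.trans ht₀.2
  have hlt : ∀ t ∈ Ico 0 a, V t = 0 := by
    intro t ht
    by_contra h
    exact absurd (csInf_le hSb ⟨⟨ht.1, ht.2.le.trans haT'⟩, h⟩) (not_le.2 ht.2)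
  have h0 : ∀ t ∈ Icc 0 a, V t = 0 := by
    have h1 : EqOn V (fun _ => 0) (Icc 0 a) := by
      have h2 : EqOn V (fun _ => 0) (Ico 0 a) := hlt
      refine h2.of_subset_closure (hV.mono (Icc_subset_Icc_right haT')) continuousOn_const
        Ico_subset_Icc_self ?_
      rw [closure_Ico ha.ne]
    exact h1
  have haT : a < T := by
    rcases haT'.lt_or_eq with h | h
    · exact h
    · exact absurd (h0 t₀ ⟨ht₀.1, h ▸ ht₀.2⟩) hVt₀
  obtain ⟨b, hb, hVb⟩ := mvf_step ha haT hf.continuousOn hganal hV heq h0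
  obtain ⟨t, ht, htb⟩ := exists_lt_of_csInf_lt hSne hb
  exact ht.2 (hVb t ⟨csInf_le hSb ht, htb.le⟩)
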